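/- (Poincaré–Miranda theorem) Let f = (f_1,…,f_n) : [0,1]^n → ℝ^n be continuous and suppose that for every i = 1,…,n one has f_i(x) ≤ 0 for all x ∈ I_i^- and f_i(x) ≥ 0 for all x ∈ I_i^+. Then there exists x ∈ [0,1]^n with f(x) = 0. -/

import Mathlib

/-- The `j`-th vertex of the Freudenthal simplex of dimension `n` encoded by `s`: the first
components of `s` give its lowest corner, the second ones the order in which the coordinates
are raised (the largest first). -/
def freudenthalVertex {n : ℕ} (s : Fin n → ℕ × ℕ) (j : ℕ) (i : Fin n) : ℕ :=
  (s i).1 + if n ≤ (s i).2 + j then 1 else 0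

/-- The Freudenthal simplices in the grid `{0, …, K}^n`. -/
noncomputable def freudenthalSimplices (n K : ℕ) : Finset (Fin n → ℕ × ℕ) :=
  open Classical in
  (Fintype.piFinset fun _ => Finset.range K ×ˢ Finset.range n).filter
    fun s => Function.Injective fun i => (s i).2

theorem mem_freudenthalSimplices {n K : ℕ} {s : Fin n → ℕ × ℕ} :
    s ∈ freudenthalSimplices n K ↔
      (∀ i, (s i).1 < K ∧ (s i).2 < n) ∧ Function.Injective fun i => (s i).2 := by
  simp [freudenthalSimplices]

/-- The facet of the simplex `s` opposite to its `j`-th vertex carries all the labels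
`0, …, n - 1`. -/
def IsFullFacet {n : ℕ} (lab : (Fin n → ℕ) → ℕ) (s : Fin n → ℕ × ℕ) (j : ℕ) : Prop :=
  ∀ m < n, ∃ l ≤ n, l ≠ j ∧ lab (freudenthalVertex s l) = m

/-- The pairs of a simplex and a vertex such that the opposite facet carries all the labels
`0, …, n - 1`. -/
noncomputable def fullFacets (n K : ℕ) (lab : (Fin n → ℕ) → ℕ) :
    Finset ((Fin n → ℕ × ℕ) × ℕ) :=
  open Classical in
  (freudenthalSimplices n K ×ˢ Finset.range (n + 1)).filter fun p => IsFullFacet lab p.1 p.2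

theorem mem_fullFacets {n K : ℕ} {lab : (Fin n → ℕ) → ℕ} {p : (Fin n → ℕ × ℕ) × ℕ} :
    p ∈ fullFacets n K lab ↔
      p.1 ∈ freudenthalSimplices n K ∧ p.2 ≤ n ∧ IsFullFacet lab p.1 p.2 := by
  simp [fullFacets, and_assoc]

theorem Finset.even_card_of_involution {α : Type*} (s : Finset α) (g : α → α)
    (hmem : ∀ a ∈ s, g a ∈ s) (hne : ∀ a ∈ s, g a ≠ a) (hinv : ∀ a ∈ s, g (g a) = a) :
    Even s.card := by
  have h : ∑ _a ∈ s, (1 : ZMod 2) = 0 :=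
    Finset.sum_involution (fun a _ => g a) (fun _ _ => by decide) (fun a ha _ => hne a ha)
      hmem hinv
  rw [Finset.sum_const, nsmul_one] at h
  exact (ZMod.natCast_eq_zero_iff_even).1 h

/-- If `n + 1` objects are labelled by `0, …, n - 1` and all labels occur after removing the
`j`-th object, then exactly one other object has the label of the `j`-th one. -/
theorem existsUnique_eq_of_surjective_off {n j : ℕ} {g : ℕ → ℕ} (hj : j ≤ n)
    (hg : ∀ l ≤ n, g l < n) (hfull : ∀ m < n, ∃ l ≤ n, l ≠ j ∧ g l = m) :
    ∃! k, k ≤ n ∧ k ≠ j ∧ g k = g j := by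
  obtain ⟨k, hk, hkj, hgk⟩ := hfull (g j) (hg j hj)
  refine ⟨k, ⟨hk, hkj, hgk⟩, ?_⟩
  rintro k' ⟨hk', hkj', hgk'⟩
  have hinj : Set.InjOn g ((Finset.range (n + 1)).erase j : Finset ℕ) := by
    refine Finset.injOn_of_surjOn_of_card_le (t := Finset.range n) g ?_ ?_ ?_
    · intro l hl
      simp only [Finset.coe_erase, Finset.coe_range, Set.mem_sdiff, Set.mem_Iio] at hl
      simpa using hg l (by omega)
    · intro m hm
      obtain ⟨l, hl, hlj, h⟩ := hfull m (by simpa using hm)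
      exact ⟨l, by simp [hlj]; omega, h⟩
    · rw [Finset.card_erase_of_mem (by simp; omega)]
      simp
  exact hinj (by simp [hkj']; omega) (by simp [hkj]; omega) (hgk'.trans hgk.symm)

theorem even_card_fullFacets {n K : ℕ} {lab : (Fin n → ℕ) → ℕ}
    (hlab : ∀ s ∈ freudenthalSimplices n K, ∀ j, IsFullFacet lab s j →
      ∀ l ≤ n, lab (freudenthalVertex s l) < n) :
    Even (fullFacets n K lab).card := by
  have key : ∀ p : (Fin n → ℕ × ℕ) × ℕ, ∃ k, p ∈ fullFacets n K lab →
      (k ≤ n ∧ k ≠ p.2 ∧ lab (freudenthalVertex p.1 k) = lab (freudenthalVertex p.1 p.2)) ∧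
      ∀ k', (k' ≤ n ∧ k' ≠ p.2 ∧
        lab (freudenthalVertex p.1 k') = lab (freudenthalVertex p.1 p.2)) → k' = k := by
    intro p
    by_cases hp : p ∈ fullFacets n K lab
    · obtain ⟨hs, hj, hfull⟩ := mem_fullFacets.1 hp
      obtain ⟨k, hk⟩ := existsUnique_eq_of_surjective_off
        (g := fun l => lab (freudenthalVertex p.1 l)) hj (hlab _ hs _ hfull) hfull
      exact ⟨k, fun _ => hk⟩
    · exact ⟨0, fun h => absurd h hp⟩
  choose g hg using key
  have hmem : ∀ p ∈ fullFacets n K lab, (p.1, g p) ∈ fullFacets n K lab := by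
    intro p hp
    obtain ⟨⟨hk, hkj, hgk⟩, huniq⟩ := hg p hp
    obtain ⟨hs, hj, hfull⟩ := mem_fullFacets.1 hp
    refine mem_fullFacets.2 ⟨hs, hk, fun m hm => ?_⟩
    obtain ⟨l, hl, hlj, h⟩ := hfull m hm
    by_cases hlk : l = g p
    · exact ⟨p.2, hj, hkj.symm, by rw [← hgk, ← hlk, h]⟩
    · exact ⟨l, hl, hlk, h⟩
  refine Finset.even_card_of_involution _ (fun p => (p.1, g p)) hmem ?_ ?_
  · intro p hp h
    exact (hg p hp).1.2.1 (congrArg Prod.snd h)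
  · intro p hp
    obtain ⟨⟨hk, hkj, hgk⟩, huniq⟩ := hg p hp
    have h2 := (hg _ (hmem p hp)).2 p.2 ⟨(mem_fullFacets.1 hp).2.1, hkj.symm, hgk.symm⟩
    exact Prod.ext rfl h2.symm

/-- The simplex sharing with `p.1` the facet opposite to the vertex `p.2`, together with the
index of its vertex opposite to that facet. -/
def adjacentSimplex {n : ℕ} (p : (Fin n → ℕ × ℕ) × ℕ) : (Fin n → ℕ × ℕ) × ℕ :=
  if p.2 = 0 then
    (fun i => if (p.1 i).2 + 1 = n then ((p.1 i).1 + 1, 0) else ((p.1 i).1, (p.1 i).2 + 1), n)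
  else if p.2 = n then
    (fun i => if (p.1 i).2 = 0 then ((p.1 i).1 - 1, n - 1) else ((p.1 i).1, (p.1 i).2 - 1), 0)
  else
    (fun i => if (p.1 i).2 + p.2 = n then ((p.1 i).1, (p.1 i).2 - 1)
      else if (p.1 i).2 + p.2 + 1 = n then ((p.1 i).1, (p.1 i).2 + 1) else p.1 i, p.2)

theorem exists_snd_eq {n K : ℕ} {s : Fin n → ℕ × ℕ} (hs : s ∈ freudenthalSimplices n K)
    {r : ℕ} (hr : r < n) : ∃ i, (s i).2 = r := by
  obtain ⟨hlt, hinj⟩ := mem_freudenthalSimplices.1 hs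
  have : Function.Injective fun i => (⟨(s i).2, (hlt i).2⟩ : Fin n) := fun a b h =>
    hinj (by simpa using h)
  obtain ⟨i, hi⟩ := Finite.surjective_of_injective this ⟨r, hr⟩
  exact ⟨i, by simpa using hi⟩

theorem adjacentSimplex_ne {n K : ℕ} {p : (Fin n → ℕ × ℕ) × ℕ} (hn : 0 < n)
    (hs : p.1 ∈ freudenthalSimplices n K) (hj : p.2 ≤ n) : adjacentSimplex p ≠ p := by
  obtain ⟨s, j⟩ := p
  intro h
  simp only at hs hj
  unfold adjacentSimplex at h
  split_ifs at h with h0 h1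
  · have := congrArg Prod.snd h
    simp only at this h0
    omega
  · have := congrArg Prod.snd h
    simp only at this h0
    omega
  · simp only at h0 h1
    obtain ⟨i, hi⟩ := exists_snd_eq hs (r := n - j) (by omega)
    have := congrArg Prod.snd (congrFun (congrArg Prod.fst h) i)
    simp only at this
    rw [if_pos (by omega)] at this
    simp only at this
    omega

theorem adjacentSimplex_adjacentSimplex {n K : ℕ} {p : (Fin n → ℕ × ℕ) × ℕ} (hn : 0 < n)
    (hs : p.1 ∈ freudenthalSimplices n K) (hj : p.2 ≤ n)
    (hbot : p.2 = n → ∀ i, p.1 i ≠ (0, 0)) : adjacentSimplex (adjacentSimplex p) = p := by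
  obtain ⟨s, j⟩ := p
  obtain ⟨hlt, -⟩ := mem_freudenthalSimplices.1 hs
  simp only at hs hj hbot hlt
  have hbot' : j = n → ∀ i, (s i).2 = 0 → 0 < (s i).1 := fun h i h2 =>
    Nat.pos_of_ne_zero fun h1 => hbot h i (Prod.ext h1 h2)
  unfold adjacentSimplex
  by_cases h0 : j = 0
  · subst h0
    simp only [if_true, hn.ne', if_false]
    refine Prod.ext (funext fun i => ?_) rfl
    have := hlt i
    simp only
    ext <;> split_ifs <;> (try simp only [not_true_eq_false] at *) <;> omega
  by_cases h1 : j = n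
  · subst h1
    simp only [if_true, hn.ne', if_false]
    refine Prod.ext (funext fun i => ?_) rfl
    have := hlt i
    have := hbot' rfl i
    simp only
    ext <;> split_ifs <;> (try simp only at *) <;> omega
  · simp only [h0, h1, if_false]
    refine Prod.ext (funext fun i => ?_) rfl
    have := hlt i
    simp only
    ext <;> split_ifs <;> (try simp only at *) <;> omega

theorem adjacentSimplex_mem {n K : ℕ} {lab : (Fin n → ℕ) → ℕ} {p : (Fin n → ℕ × ℕ) × ℕ}
    (hn : 0 < n) (hp : p ∈ fullFacets n K lab)
    (htop : ∀ (x : Fin n → ℕ) (i : Fin n), x i = K → lab x ≠ i)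
    (hbot : p.2 = n → ∀ i, p.1 i ≠ (0, 0)) : adjacentSimplex p ∈ fullFacets n K lab := by
  obtain ⟨s, j⟩ := p
  obtain ⟨hs, hj, hfull⟩ := mem_fullFacets.1 hp
  obtain ⟨hlt, hinj⟩ := mem_freudenthalSimplices.1 hs
  simp only at hs hj hbot hlt hinj hfull
  have hbot' : j = n → ∀ i, (s i).2 = 0 → 0 < (s i).1 := fun h i h2 =>
    Nat.pos_of_ne_zero fun h1 => hbot h i (Prod.ext h1 h2)
  unfold adjacentSimplex
  by_cases h0 : j = 0
  · subst h0
    have htop' : ∀ i, (s i).2 + 1 = n → (s i).1 + 1 < K := by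
      intro i h2
      by_contra hK
      obtain ⟨l, hl, hl0, h⟩ := hfull i i.2
      refine htop _ i ?_ h
      have := hlt i
      rw [freudenthalVertex, if_pos (by omega)]
      omega
    simp only [if_true]
    refine mem_fullFacets.2 ⟨mem_freudenthalSimplices.2 ⟨fun i => ?_, fun a b h => hinj ?_⟩,
      le_rfl, fun m hm => ?_⟩
    · have := hlt i
      have := htop' i
      simp only
      split_ifs <;> simp only <;> omega
    · have := hlt a
      have := hlt b
      simp only at h ⊢
      split_ifs at h <;> simp only at h <;> omega
    · obtain ⟨l, hl, hl0, h⟩ := hfull m hm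
      refine ⟨l - 1, by omega, by simp only; omega, ?_⟩
      rw [← h]
      congr 1
      ext i
      have := hlt i
      simp only [freudenthalVertex]
      split_ifs <;> simp only at * <;> omega
  by_cases h1 : j = n
  · subst h1
    simp only [if_true, hn.ne', if_false]
    refine mem_fullFacets.2 ⟨mem_freudenthalSimplices.2 ⟨fun i => ?_, fun a b h => hinj ?_⟩,
      Nat.zero_le _, fun m hm => ?_⟩
    · have := hlt i
      simp only
      split_ifs <;> simp only <;> omega
    · have := hlt a
      have := hlt b
      simp only at h ⊢
      split_ifs at h <;> simp only at h <;> omega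
    · obtain ⟨l, hl, hl0, h⟩ := hfull m hm
      refine ⟨l + 1, by omega, by simp only; omega, ?_⟩
      rw [← h]
      congr 1
      ext i
      have := hlt i
      have := hbot' rfl i
      simp only [freudenthalVertex]
      split_ifs <;> simp only at * <;> omega
  · simp only [h0, h1, if_false]
    refine mem_fullFacets.2 ⟨mem_freudenthalSimplices.2 ⟨fun i => ?_, fun a b h => hinj ?_⟩,
      hj, fun m hm => ?_⟩
    · have := hlt i
      simp only
      split_ifs <;> (try simp only) <;> omega
    · have := hlt a
      have := hlt b
      simp only at h ⊢
      split_ifs at h <;> (try simp only at h) <;> omega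
    · obtain ⟨l, hl, hl0, h⟩ := hfull m hm
      refine ⟨l, hl, hl0, ?_⟩
      rw [← h]
      congr 1
      ext i
      have := hlt i
      simp only [freudenthalVertex]
      split_ifs <;> simp only at * <;> omega

/-- The simplex with lowest corner `0` whose coordinates are raised in increasing order. -/
def cornerSimplex (n : ℕ) (i : Fin n) : ℕ × ℕ := (0, n - 1 - i)

theorem freudenthalVertex_cornerSimplex {n : ℕ} (j : ℕ) (i : Fin n) :
    freudenthalVertex (cornerSimplex n) j i = if (i : ℕ) < j then 1 else 0 := by
  unfold freudenthalVertex cornerSimplex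
  split_ifs <;> simp only at * <;> omega

theorem cornerSimplex_mem_fullFacets {n K : ℕ} {lab : (Fin n → ℕ) → ℕ} (hK : 0 < K)
    (hzero : ∀ (x : Fin n → ℕ) (i : Fin n), x i = 0 → (∀ i' < i, x i' ≠ 0) → lab x = i) :
    (cornerSimplex n, n) ∈ fullFacets n K lab := by
  refine mem_fullFacets.2 ⟨mem_freudenthalSimplices.2 ⟨fun i => ?_, fun a b h => ?_⟩, le_rfl,
    fun m hm => ⟨m, hm.le, hm.ne, hzero _ ⟨m, hm⟩ ?_ fun i hi => ?_⟩⟩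
  · simp only [cornerSimplex]
    omega
  · simp only [cornerSimplex] at h
    omega
  · simp [freudenthalVertex_cornerSimplex]
  · have : (i : ℕ) < m := hi
    simp [freudenthalVertex_cornerSimplex, this]

theorem eq_cornerSimplex {n K : ℕ} {lab : (Fin n → ℕ) → ℕ} {s : Fin n → ℕ × ℕ}
    (hzero : ∀ (x : Fin n → ℕ) (i : Fin n), x i = 0 → (∀ i' < i, x i' ≠ 0) → lab x = i)
    (hp : (s, n) ∈ fullFacets n K lab) {i₀ : Fin n} (hi₀ : s i₀ = (0, 0)) :
    s = cornerSimplex n := by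
  obtain ⟨hs, -, hfull⟩ := mem_fullFacets.1 hp
  obtain ⟨hlt, -⟩ := mem_freudenthalSimplices.1 hs
  simp only at hs hfull hlt
  have key : ∀ m : Fin n, ∃ l < n, freudenthalVertex s l m = 0 ∧
      ∀ m' < m, freudenthalVertex s l m' ≠ 0 := by
    intro m
    obtain ⟨l, hl, hln, h⟩ := hfull m m.2
    have hl' : l < n := by omega
    have hex : freudenthalVertex s l i₀ = 0 := by
      simp only [freudenthalVertex, hi₀]
      rw [if_neg (by omega)]
    obtain ⟨a, ha, hmin⟩ := WellFounded.has_min (wellFounded_lt (α := Fin n))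
      {a | freudenthalVertex s l a = 0} ⟨i₀, hex⟩
    have hmin' : ∀ m' < a, freudenthalVertex s l m' ≠ 0 := fun m' hm' h0 => hmin m' h0 hm'
    have ham : a = m := Fin.ext ((hzero _ a ha hmin').symm.trans h)
    subst ham
    exact ⟨l, hl', ha, hmin'⟩
  have hfst : ∀ m, (s m).1 = 0 := by
    intro m
    obtain ⟨l, -, h, -⟩ := key m
    simp only [freudenthalVertex] at h
    omega
  have hanti : ∀ m' m : Fin n, m' < m → (s m).2 < (s m').2 := by
    intro m' m hm
    obtain ⟨l, -, h, h'⟩ := key m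
    have h' := h' m' hm
    have := hfst m'
    simp only [freudenthalVertex] at h h'
    split_ifs at h h' <;> omega
  let g : Fin n → Fin n := fun i => ⟨n - 1 - (s i).2, by have := i.2; omega⟩
  have hg : StrictMono g := by
    intro a b hab
    have := hanti a b hab
    have := hlt a
    simp only [g, Fin.mk_lt_mk]
    omega
  ext i
  · exact hfst i
  · have h1 : i ≤ g i := hg.le_apply
    have h2 : g i ≤ i := hg.apply_le
    have := hlt i
    simp only [g, Fin.le_def] at h1 h2
    simp only [cornerSimplex]
    omega

theorem odd_card_fullFacets {n K : ℕ} {lab : (Fin n → ℕ) → ℕ} (hn : 0 < n) (hK : 0 < K)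
    (hzero : ∀ (x : Fin n → ℕ) (i : Fin n), x i = 0 → (∀ i' < i, x i' ≠ 0) → lab x = i)
    (htop : ∀ (x : Fin n → ℕ) (i : Fin n), x i = K → lab x ≠ i) :
    Odd (fullFacets n K lab).card := by
  classical
  have hc := cornerSimplex_mem_fullFacets hK hzero
  rw [← Finset.card_erase_add_one hc]
  have hbot : ∀ p ∈ (fullFacets n K lab).erase (cornerSimplex n, n),
      p.2 = n → ∀ i, p.1 i ≠ (0, 0) := by
    rintro ⟨s, j⟩ hp h i hi
    obtain ⟨hne, hp⟩ := Finset.mem_erase.1 hp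
    simp only at h hi
    subst h
    exact hne (by rw [eq_cornerSimplex hzero hp hi])
  refine Even.add_one (Finset.even_card_of_involution _ adjacentSimplex ?_ ?_ ?_)
  · intro p hp
    have hb := hbot p hp
    obtain ⟨hne, hp'⟩ := Finset.mem_erase.1 hp
    obtain ⟨hs, hj, -⟩ := mem_fullFacets.1 hp'
    refine Finset.mem_erase.2 ⟨fun h => ?_, adjacentSimplex_mem hn hp' htop hb⟩
    have hinv := adjacentSimplex_adjacentSimplex hn hs hj hb
    have hlast : (adjacentSimplex p).1 ⟨n - 1, by omega⟩ = (0, 0) := by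
      rw [h]
      simp [cornerSimplex]
    have hsnd : (adjacentSimplex p).2 = n := by rw [h]
    unfold adjacentSimplex at hlast hsnd
    split_ifs at hlast hsnd with h0 h1
    · simp only at hlast
      split_ifs at hlast <;> simp at hlast
    · simp only at hsnd
      omega
    · exact h1 hsnd
  · intro p hp
    obtain ⟨hs, hj, -⟩ := mem_fullFacets.1 (Finset.mem_of_mem_erase hp)
    exact adjacentSimplex_ne hn hs hj
  · intro p hp
    obtain ⟨hs, hj, -⟩ := mem_fullFacets.1 (Finset.mem_of_mem_erase hp)
    exact adjacentSimplex_adjacentSimplex hn hs hj (hbot p hp)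

/-- A cubical Sperner lemma: a suitably labelled grid has a simplex carrying all labels. -/
theorem exists_full_freudenthalSimplex {n K : ℕ} {lab : (Fin n → ℕ) → ℕ} (hn : 0 < n)
    (hK : 0 < K) (hle : ∀ x, lab x ≤ n)
    (hzero : ∀ (x : Fin n → ℕ) (i : Fin n), x i = 0 → (∀ i' < i, x i' ≠ 0) → lab x = i)
    (htop : ∀ (x : Fin n → ℕ) (i : Fin n), x i = K → lab x ≠ i) :
    ∃ s : Fin n → ℕ × ℕ, ∀ m ≤ n, ∃ l, lab (freudenthalVertex s l) = m := by
  by_contra! hcon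
  refine (Nat.not_even_iff_odd.2 (odd_card_fullFacets hn hK hzero htop))
    (even_card_fullFacets fun s _ j hfull l _ => ?_)
  obtain ⟨m, hm, hne⟩ := hcon s
  refine lt_of_le_of_ne (hle _) fun h => ?_
  rcases hm.lt_or_eq with hm | rfl
  · obtain ⟨l', -, -, h'⟩ := hfull m hm
    exact hne l' h'
  · exact hne l h

/-- The point `x / K` of the cube, for `x` in the grid `{0, …, K}^n`. -/
noncomputable def gridPoint {n : ℕ} (K : ℕ) (x : Fin n → ℕ) (i : Fin n) : unitInterval :=
  Set.projIcc (0 : ℝ) 1 zero_le_one (x i / K)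

theorem dist_gridPoint_freudenthalVertex_le {n K : ℕ} (s : Fin n → ℕ × ℕ) (l l' : ℕ) :
    dist (gridPoint K (freudenthalVertex s l)) (gridPoint K (freudenthalVertex s l')) ≤
      1 / K := by
  refine (dist_pi_le_iff (by positivity)).2 fun i => ?_
  rw [Subtype.dist_eq, Real.dist_eq]
  refine (Set.abs_projIcc_sub_projIcc _).trans ?_
  rw [← sub_div, abs_div, Nat.abs_cast]
  gcongr
  simp only [freudenthalVertex]
  split_ifs <;> simp

theorem exists_gridLabel {n K : ℕ} (hK : 0 < K)
    (f : (Fin n → unitInterval) → Fin n → ℝ)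
    (hminus : ∀ (i : Fin n) (x : Fin n → unitInterval), x i = 0 → f x i ≤ 0)
    (hplus : ∀ (i : Fin n) (x : Fin n → unitInterval), x i = 1 → 0 ≤ f x i)
    (x : Fin n → ℕ) :
    ∃ m ≤ n, (∀ i : Fin n, x i = 0 → (∀ i' < i, x i' ≠ 0) → m = i) ∧
      (∀ i : Fin n, x i = K → m ≠ i) ∧
      (∀ i : Fin n, m = i → f (gridPoint K x) i ≤ 0) ∧
      (m = n → ∀ i, 0 ≤ f (gridPoint K x) i) := by
  by_cases h : ∃ i, x i = 0
  · obtain ⟨a, ha, hmin⟩ := WellFounded.has_min (wellFounded_lt (α := Fin n)) {a | x a = 0} h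
    refine ⟨a, a.2.le, fun i hi hi' => ?_, fun i hi hai => ?_, fun i hai => ?_,
      fun han => absurd han a.2.ne⟩
    · rcases lt_trichotomy a i with hlt | rfl | hlt
      · exact absurd ha (hi' a hlt)
      · rfl
      · exact absurd hlt (hmin i hi)
    · obtain rfl := Fin.ext hai
      have : x a = 0 := ha
      omega
    · obtain rfl := Fin.ext hai
      have : x a = 0 := ha
      exact hminus _ _ (by simp [gridPoint, this])
  · push Not at h
    by_cases hneg : ∃ i, f (gridPoint K x) i < 0
    · obtain ⟨a, ha⟩ := hneg
      refine ⟨a, a.2.le, fun i hi => absurd hi (h i), fun i hi hai => ?_, fun i hai => ?_,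
        fun han => absurd han a.2.ne⟩
      · obtain rfl := Fin.ext hai
        refine ha.not_ge (hplus _ _ ?_)
        have : (K : ℝ) ≠ 0 := by positivity
        simp [gridPoint, hi, this]
      · obtain rfl := Fin.ext hai
        exact ha.le
    · push Not at hneg
      exact ⟨n, le_rfl, fun i hi => absurd hi (h i), fun i _ h => i.2.ne' h,
        fun i h => absurd h i.2.ne', fun _ => hneg⟩

/-- **Poincaré–Miranda theorem.** Let `f = (f_1,…,f_n) : [0,1]^n → ℝ^n` be continuous with
`f_i ≤ 0` on the face `I_i^- = {x : x_i = 0}` and `f_i ≥ 0` on the face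
`I_i^+ = {x : x_i = 1}`, for every `i`. Then `f(x) = 0` for some `x ∈ [0,1]^n`. -/
theorem poincare_miranda (n : ℕ)
    (f : (Fin n → unitInterval) → Fin n → ℝ) (hf : Continuous f)
    (hminus : ∀ (i : Fin n) (x : Fin n → unitInterval), x i = 0 → f x i ≤ 0)
    (hplus : ∀ (i : Fin n) (x : Fin n → unitInterval), x i = 1 → 0 ≤ f x i) :
    ∃ x : Fin n → unitInterval, f x = 0 := by
  rcases Nat.eq_zero_or_pos n with rfl | hn
  · exact ⟨fun _ => 0, Subsingleton.elim _ _⟩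
  obtain ⟨x, -, hx⟩ := isCompact_univ.exists_isMinOn (Set.univ_nonempty)
    (hf.norm.continuousOn (s := Set.univ))
  refine ⟨x, norm_le_zero_iff.1 (le_of_forall_pos_le_add fun ε hε => ?_)⟩
  obtain ⟨δ, hδ, hfδ⟩ := Metric.uniformContinuous_iff.1
    (CompactSpace.uniformContinuous_of_continuous hf) ε hε
  obtain ⟨k, hk⟩ := exists_nat_one_div_lt hδ
  choose lab hle hzero htop hneg hpos using
    exists_gridLabel (K := k + 1) k.succ_pos f hminus hplus
  obtain ⟨s, hs⟩ := exists_full_freudenthalSimplex hn k.succ_pos hle hzero htop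
  obtain ⟨l, hl⟩ := hs n le_rfl
  rw [zero_add]
  refine (hx (Set.mem_univ (gridPoint (k + 1) (freudenthalVertex s l)))).trans
    ((pi_norm_le_iff_of_nonneg hε.le).2 fun i => ?_)
  obtain ⟨l', hl'⟩ := hs i i.2.le
  have h1 := hpos _ hl i
  have h2 := hneg _ i hl'
  have h3 := (dist_le_pi_dist _ _ i).trans (hfδ
    ((dist_gridPoint_freudenthalVertex_le (K := k + 1) s l l').trans_lt (by exact_mod_cast hk))).le
  rw [Real.dist_eq] at h3
  rw [Real.norm_eq_abs, abs_of_nonneg h1]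
  linarith [le_abs_self (f (gridPoint (k + 1) (freudenthalVertex s l)) i -
    f (gridPoint (k + 1) (freudenthalVertex s l')) i)]
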